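/- Let i be a node of a finite directed network with edge sets δ⁺ (edges with tail i) and δ⁻ (edges with head i). Suppose each incident edge e carries a flow q_e = q_e⁺ − q_e⁻ and a direction indicator y_e ∈ {0, 1} with 0 ≤ q_e⁺ ≤ M_e⁺·y_e and 0 ≤ q_e⁻ ≤ M_e⁻·(1 − y_e) for some nonnegative constants M_e⁺, M_e⁻, and suppose flow conservation holds at i with net outflow s_i < 0, i.e., Σ_{e ∈ δ⁺} q_e − Σ_{e ∈ δ⁻} q_e = s_i. Then Σ_{e ∈ δ⁻} y_e + Σ_{e ∈ δ⁺} (1 − y_e) ≥ 1. -/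

import Mathlib

open Finset

/-- Direction-based valid inequality at a consumption node: if each incident
edge carries flow `q_e = q_e⁺ − q_e⁻` with direction indicator `y_e ∈ {0,1}`
activating the directed components, and the net outflow at the node is
negative, then at least one incoming edge is directed toward the node or one
outgoing edge is directed backward: `∑_{δ⁻} y_e + ∑_{δ⁺} (1 − y_e) ≥ 1`. -/
theorem stmt_19 {E : Type*} [Fintype E] [DecidableEq E] (δp δm : Finset E)
    (qp qm Mp Mm y q : E → ℝ)
    (hq : ∀ e, q e = qp e - qm e)
    (hy : ∀ e, y e = 0 ∨ y e = 1)
    (hMp : ∀ e, 0 ≤ Mp e) (hMm : ∀ e, 0 ≤ Mm e)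
    (hqp : ∀ e, 0 ≤ qp e ∧ qp e ≤ Mp e * y e)
    (hqm : ∀ e, 0 ≤ qm e ∧ qm e ≤ Mm e * (1 - y e))
    (s : ℝ) (hs : s < 0)
    (hcons : (∑ e ∈ δp, q e) - (∑ e ∈ δm, q e) = s) :
    (∑ e ∈ δm, y e) + (∑ e ∈ δp, (1 - y e)) ≥ 1 := by
  have hy0 : ∀ e, 0 ≤ y e := fun e => by rcases hy e with h | h <;> simp [h]
  have hy1 : ∀ e, 0 ≤ 1 - y e := fun e => by rcases hy e with h | h <;> simp [h]
  have hm0 : 0 ≤ ∑ e ∈ δm, y e := sum_nonneg fun e _ => hy0 e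
  have hp0 : 0 ≤ ∑ e ∈ δp, (1 - y e) := sum_nonneg fun e _ => hy1 e
  by_cases hm : ∃ e ∈ δm, y e = 1
  · obtain ⟨e, he, h⟩ := hm
    have := single_le_sum (fun e _ => hy0 e) he
    linarith
  by_cases hp : ∃ e ∈ δp, y e = 0
  · obtain ⟨e, he, h⟩ := hp
    have := single_le_sum (f := fun e => 1 - y e) (fun e _ => hy1 e) he
    linarith
  push Not at hm hp
  have hout : 0 ≤ ∑ e ∈ δp, q e := sum_nonneg fun e he => by
    have h := hqm e
    rw [(hy e).resolve_left (hp e he), sub_self, mul_zero] at h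
    linarith [hq e, (hqp e).1]
  have hin : ∑ e ∈ δm, q e ≤ 0 := sum_nonpos fun e he => by
    have h := hqp e
    rw [(hy e).resolve_right (hm e he), mul_zero] at h
    linarith [hq e, (hqm e).1]
  linarith
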